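/- Let 𝒞 be the class of undirected graphs that are finite disjoint unions of finite undirected paths. For each B ≥ 2, the condition 'there are at least B connected components (paths, including isolated vertices)' is FO-definable by a sentence φ; φ ∈ PSC(B) over 𝒞 (in every model in 𝒞 the set consisting of one endpoint of each of B distinct paths is a core), but φ is not equivalent over 𝒞 to any sentence of the form ∃x₁…∃x_B ∀y₁…∀y_n β with β quantifier-free. -/

import Mathlib

open FirstOrder Language

universe u v

namespace Stmt

variable {L : FirstOrder.Language.{u, v}}

/-- Universally quantify the last `k` bound variables of a bounded formula. -/
def allsK {n : ℕ} : (k : ℕ) → L.BoundedFormula Empty (n + k) → L.BoundedFormula Empty n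
  | 0, φ => φ
  | k + 1, φ => allsK k φ.all

/-- Existentially quantify the last `k` bound variables of a bounded formula. -/
def exsK {n : ℕ} : (k : ℕ) → L.BoundedFormula Empty (n + k) → L.BoundedFormula Empty n
  | 0, φ => φ
  | k + 1, φ => exsK k φ.ex

/-- The Σ⁰₂ sentence `∃x₁…x_B ∀y₁…y_n β` (for `β` quantifier-free). -/
def sigma2 (B n : ℕ) (β : L.BoundedFormula Empty (B + n)) : L.Sentence :=
  (allsK n β).exs

/-- The Π⁰₂ sentence `∀x₁…x_k ∃y₁…y_m β` (for `β` quantifier-free). -/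
def pi2 (k m : ℕ) (β : L.BoundedFormula Empty (k + m)) : L.Sentence :=
  (exsK m β).alls

/-- `C` is a core of the structure `M` w.r.t. `φ`: every (nonempty) substructure of `M`
whose universe contains `C` satisfies `φ`. -/
def IsCore (φ : L.Sentence) (M : Type max u v) [L.Structure M] (C : Set M) : Prop :=
  ∀ N : L.Substructure M, C ⊆ (N : Set M) → Nonempty N → ↥N ⊨ φ

/-- `φ` is preserved under substructures modulo a finite core: every model of `φ`
has a finite core w.r.t. `φ`. -/
def PSCf (φ : L.Sentence) : Prop :=
  ∀ (M : Type max u v) [L.Structure M] [Nonempty M],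
    M ⊨ φ → ∃ C : Set M, C.Finite ∧ IsCore φ M C

/-- `φ ∈ PSC(B)`: every model of `φ` has a core of size at most `B` w.r.t. `φ`. -/
def PSC (φ : L.Sentence) (B : ℕ) : Prop :=
  ∀ (M : Type max u v) [L.Structure M] [Nonempty M],
    M ⊨ φ → ∃ C : Finset M, C.card ≤ B ∧ IsCore φ M ↑C

/-- Logical equivalence of sentences: they hold in exactly the same (nonempty) structures. -/
def Equiv (φ ψ : L.Sentence) : Prop :=
  ∀ (M : Type max u v) [L.Structure M] [Nonempty M], M ⊨ φ ↔ M ⊨ ψ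

/-- The edge relation of a structure for the language with a single binary relation. -/
abbrev E (M : Type) [Language.graph.Structure M] (x y : M) : Prop :=
  Structure.RelMap Language.adj ![x, y]

/-- Membership in the class 𝒞 of undirected graphs that are finite disjoint unions of finite
undirected paths: the structure is finite, the edge relation is symmetric and irreflexive,
every vertex has degree at most 2, and there is no (undirected) cycle, i.e. no injective
cyclically-ordered sequence of at least 3 vertices with consecutive edges. -/
def InUndirPaths (M : Type) [Language.graph.Structure M] : Prop :=
  Finite M ∧
  (∀ x y : M, E M x y → E M y x) ∧
  (∀ x : M, ¬ E M x x) ∧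
  (∀ v u₁ u₂ u₃ : M, E M v u₁ → E M v u₂ → E M v u₃ → (u₁ = u₂ ∨ u₁ = u₃ ∨ u₂ = u₃)) ∧
  ∀ (m : ℕ) (f : Fin (m + 3) → M), Function.Injective f → ¬ ∀ i, E M (f i) (f (i + 1))

/-- `M` has at least `B` connected components: there are `B` vertices that are pairwise
unreachable from one another. -/
def AtLeastComponents (M : Type) [Language.graph.Structure M] (B : ℕ) : Prop :=
  ∃ f : Fin B → M, ∀ i j : Fin B, i ≠ j → ¬ Relation.ReflTransGen (E M) (f i) (f j)


theorem forest_sum {V : Type} [Fintype V] [DecidableEq V] (G : SimpleGraph V) [DecidableRel G.Adj]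
    [Fintype G.ConnectedComponent]
    (hG : G.IsAcyclic) : ∑ v, ((2 : ℤ) - G.degree v) = 2 * Fintype.card G.ConnectedComponent := by
  classical
  rw [← Finset.sum_fiberwise (s := Finset.univ) (g := G.connectedComponentMk)]
  have key : ∀ C : G.ConnectedComponent,
      ∑ v with G.connectedComponentMk v = C, ((2 : ℤ) - G.degree v) = 2 := by
    intro C
    have ht : (G.induce C.supp).IsTree := ⟨C.connected_toSimpleGraph, hG.induce _⟩
    have hc := ht.card_edgeFinset
    have hs := (G.induce C.supp).sum_degrees_eq_twice_card_edges
    have e1 : ∑ v with G.connectedComponentMk v = C, ((2 : ℤ) - G.degree v)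
        = ∑ v : C.supp, ((2 : ℤ) - G.degree v) := by
      apply Finset.sum_subtype
      intro x; simp
    have e2 : ∀ v : C.supp, G.degree v = (G.induce C.supp).degree v := by
      intro v
      symm
      convert SimpleGraph.degree_induce_of_neighborSet_subset (G := G) (s := C.supp) (v := v) ?_
      intro w hw
      exact C.mem_supp_of_adj_mem_supp v.2 hw
    rw [e1, Finset.sum_sub_distrib]
    simp only [e2]
    rw [← Nat.cast_sum, hs]
    simp only [Finset.sum_const, Finset.card_univ, nsmul_eq_mul]
    rw [← hc]
    push_cast
    ring
  rw [Finset.sum_congr rfl (fun C _ => key C)]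
  simp [mul_comm]

/-- Semantic meaning of the sentence. -/
def Sem (M : Type) [Language.graph.Structure M] (B : ℕ) : Prop :=
  ∃ x : Fin (2 * B) → M, ∃ c : Fin (2 * B) → Bool,
    (∀ i j, i ≠ j → c i = c j → x i ≠ x j) ∧
    (∀ i, ∀ u w, E M (x i) u → E M (x i) w → u = w) ∧
    (∀ i, c i = true → ∀ u, ¬ E M (x i) u)

def mkG (M : Type) [Language.graph.Structure M] (h : InUndirPaths M) : SimpleGraph M where
  Adj := E M
  symm := ⟨fun x y => h.2.1 x y⟩
  loopless := ⟨fun x => h.2.2.1 x⟩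

theorem mkG_acyclic (M : Type) [Language.graph.Structure M] (h : InUndirPaths M) :
    (mkG M h).IsAcyclic := by
  rw [SimpleGraph.isAcyclic_iff_free_cycleGraph]
  rintro n hn ⟨f⟩
  obtain ⟨m, rfl⟩ : ∃ m, n = m + 3 := ⟨n - 3, by omega⟩
  refine h.2.2.2.2 m f.toHom f.injective' ?_
  intro i
  have : (SimpleGraph.cycleGraph (m + 3)).Adj i (i + 1) := by
    rw [SimpleGraph.cycleGraph_adj]
    right; simp
  exact f.toHom.map_rel this

theorem atLeast_iff (M : Type) [Language.graph.Structure M] (h : InUndirPaths M) (B : ℕ)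
    [Fintype (mkG M h).ConnectedComponent] :
    AtLeastComponents M B ↔ B ≤ Fintype.card (mkG M h).ConnectedComponent := by
  have hr : ∀ x y, Relation.ReflTransGen (E M) x y ↔ (mkG M h).Reachable x y := by
    intro x y
    rw [SimpleGraph.reachable_iff_reflTransGen]; rfl
  constructor
  · rintro ⟨f, hf⟩
    have : Function.Injective (fun i => (mkG M h).connectedComponentMk (f i)) := by
      intro i j hij
      by_contra hne
      exact hf i j hne ((hr _ _).2 (SimpleGraph.ConnectedComponent.exact hij))
    simpa using Fintype.card_le_of_injective _ this
  · intro hB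
    have : Fintype.card (Fin B) ≤ Fintype.card (mkG M h).ConnectedComponent := by simpa using hB
    obtain ⟨e⟩ := Function.Embedding.nonempty_of_card_le this
    refine ⟨fun i => (e i).out, fun i j hij hh => hij ?_⟩
    have := SimpleGraph.ConnectedComponent.sound ((hr _ _).1 hh)
    apply e.injective
    rw [← Quot.out_eq (e i), ← Quot.out_eq (e j)]
    exact this

theorem sem_iff (M : Type) [Language.graph.Structure M] (h : InUndirPaths M) (B : ℕ) :
    Sem M B ↔ AtLeastComponents M B := by
  classical
  haveI := h.1
  letI := Fintype.ofFinite M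
  letI : Fintype (mkG M h).ConnectedComponent := Fintype.ofFinite _
  rw [atLeast_iff M h]
  have hs := forest_sum (mkG M h) (mkG_acyclic M h)
  have hd2 : ∀ v, (mkG M h).degree v ≤ 2 := by
    intro v
    by_contra hc
    push Not at hc
    obtain ⟨a, b, c, ha, hb, hc, h1, h2, h3⟩ := Finset.two_lt_card_iff.1 hc
    rw [SimpleGraph.mem_neighborFinset] at ha hb hc
    rcases h.2.2.2.1 v a b c ha hb hc with h | h | h
    exacts [h1 h, h2 h, h3 h]
  have hd1 : ∀ v, (∀ u w, E M v u → E M v w → u = w) ↔ (mkG M h).degree v ≤ 1 := by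
    intro v
    rw [← SimpleGraph.card_neighborFinset_eq_degree, Finset.card_le_one]
    simp only [SimpleGraph.mem_neighborFinset]
    constructor
    · intro hh a ha b hb; exact hh a b ha hb
    · intro hh a b ha hb; exact hh a ha b hb
  have hd0 : ∀ v, (∀ u, ¬ E M v u) ↔ (mkG M h).degree v = 0 := by
    intro v
    rw [← SimpleGraph.card_neighborFinset_eq_degree, Finset.card_eq_zero,
      Finset.eq_empty_iff_forall_notMem]
    simp only [SimpleGraph.mem_neighborFinset]
    rfl
  set P : M × Bool → Prop := fun p => (mkG M h).degree p.1 ≤ 1 ∧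
    (p.2 = true → (mkG M h).degree p.1 = 0) with hP
  have hsem : Sem M B ↔ 2 * B ≤ Fintype.card {p // P p} := by
    constructor
    · rintro ⟨x, c, h1, h2, h3⟩
      have : Function.Injective (fun i => (⟨(x i, c i), (hd1 _).1 (h2 i),
          fun hc => (hd0 _).1 (h3 i hc)⟩ : {p // P p})) := by
        intro i j hij
        simp only [Subtype.mk.injEq, Prod.mk.injEq] at hij
        by_contra hne
        exact h1 i j hne hij.2 hij.1
      simpa using Fintype.card_le_of_injective _ this
    · intro hle
      have : Fintype.card (Fin (2 * B)) ≤ Fintype.card {p // P p} := by simpa using hle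
      obtain ⟨e⟩ := Function.Embedding.nonempty_of_card_le this
      refine ⟨fun i => (e i).1.1, fun i => (e i).1.2, ?_, ?_, ?_⟩
      · intro i j hij hc hx
        exact hij (e.injective (Subtype.ext (Prod.ext hx hc)))
      · intro i; exact (hd1 _).2 (e i).2.1
      · intro i hc; exact (hd0 _).2 ((e i).2.2 hc)
  have hcard : (Fintype.card {p // P p} : ℤ) = ∑ v, ((2 : ℤ) - (mkG M h).degree v) := by
    rw [Fintype.card_subtype, Finset.card_filter, Fintype.sum_prod_type]
    push_cast
    refine Finset.sum_congr rfl (fun v _ => ?_)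
    have := hd2 v
    simp only [hP, Fintype.sum_bool]
    generalize (mkG M h).degree v = d at this
    interval_cases d <;> simp
  rw [hsem]
  omega

/-- The sentence. -/
noncomputable def theSentence (B : ℕ) : Language.graph.Sentence :=
  Formula.iExs (Fin (2 * B)) (α := Empty) <|
    Formula.iSup fun c : Fin (2 * B) → Bool =>
      (Formula.iInf fun ij : {ij : Fin (2 * B) × Fin (2 * B) // ij.1 ≠ ij.2 ∧ c ij.1 = c ij.2} =>
        ∼((Term.var (Sum.inr ij.1.1)).equal (Term.var (Sum.inr ij.1.2)))) ⊓
      ((Formula.iInf fun i : Fin (2 * B) =>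
        ∀' ∀' ((adj.boundedFormula₂ (Term.var (Sum.inl (Sum.inr i))) (Term.var (Sum.inr 0))) ⟹
          ((adj.boundedFormula₂ (Term.var (Sum.inl (Sum.inr i))) (Term.var (Sum.inr 1))) ⟹
          ((Term.var (Sum.inr 0)) =' (Term.var (Sum.inr 1)))))) ⊓
      (Formula.iInf fun i : {i : Fin (2 * B) // c i = true} =>
        ∀' ∼(adj.boundedFormula₂ (Term.var (Sum.inl (Sum.inr i.1))) (Term.var (Sum.inr 0)))))

theorem realize_theSentence (M : Type) [Language.graph.Structure M] (B : ℕ) :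
    M ⊨ theSentence B ↔ Sem M B := by
  unfold theSentence Sem Sentence.Realize
  rw [Formula.realize_iExs]
  refine exists_congr fun x => ?_
  rw [Formula.realize_iSup]
  refine exists_congr fun c => ?_
  rw [Formula.realize_inf, Formula.realize_inf, Formula.realize_iInf, Formula.realize_iInf,
    Formula.realize_iInf]
  refine and_congr ?_ (and_congr ?_ ?_)
  · simp [Formula.realize_not, Formula.realize_equal]
  · simp [Formula.Realize, BoundedFormula.realize_rel₂, Fin.snoc]
  · simp [Formula.Realize, BoundedFormula.realize_rel₂, Fin.snoc]

theorem realize_allsK {M : Type} [Language.graph.Structure M] {n : ℕ} (k : ℕ)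
    (φ : Language.graph.BoundedFormula Empty (n + k)) (v : Empty → M) (xs : Fin n → M) :
    (allsK k φ).Realize v xs ↔
      ∀ t : Fin (n + k) → M, (∀ i, t (Fin.castAdd k i) = xs i) → φ.Realize v t := by
  induction k with
  | zero =>
    simp only [allsK]
    constructor
    · intro h t ht
      have : t = xs := funext ht
      rwa [this]
    · intro h
      exact h xs fun _ => rfl
  | succ k ih =>
    simp only [allsK]
    rw [ih]
    simp only [BoundedFormula.realize_all]
    constructor
    · intro h t ht
      have := h (fun i => t i.castSucc) (fun i => ht i) (t (Fin.last _))
      have e : Fin.snoc (α := fun _ => M) (fun i : Fin (n + k) => t i.castSucc) (t (Fin.last _)) = t :=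
        Fin.snoc_init_self t
      rw [e] at this
      exact this
    · intro h t ht z
      apply h
      intro i
      have : Fin.castAdd (k + 1) i = (Fin.castAdd k i).castSucc := rfl
      rw [this, Fin.snoc_castSucc, ht]

theorem realize_sigma2 {M : Type} [Language.graph.Structure M] (B n : ℕ)
    (β : Language.graph.BoundedFormula Empty (B + n)) :
    M ⊨ sigma2 B n β ↔ ∃ a : Fin B → M,
      ∀ t : Fin (B + n) → M, (∀ i, t (Fin.castAdd n i) = a i) → β.Realize default t := by
  unfold sigma2 Sentence.Realize
  rw [BoundedFormula.realize_exs]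
  simp only [realize_allsK]

theorem qf_transfer {M N : Type} [Language.graph.Structure M] [Language.graph.Structure N]
    {m : ℕ} (β : Language.graph.BoundedFormula Empty m) (hβ : β.IsQF)
    (t : Fin m → N) (t' : Fin m → M)
    (heq : ∀ i j, t i = t j ↔ t' i = t' j) (hE : ∀ i j, E N (t i) (t j) ↔ E M (t' i) (t' j)) :
    β.Realize default t ↔ β.Realize default t' := by
  have hterm : ∀ s : Language.graph.Term (Empty ⊕ Fin m), ∃ i, s = Term.var (Sum.inr i) := by
    intro s
    cases s with
    | var x =>
      rcases x with x | x
      · exact x.elim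
      · exact ⟨x, rfl⟩
    | func f _ => exact isEmptyElim f
  induction hβ with
  | falsum => exact Iff.rfl
  | of_isAtomic h =>
    cases h with
    | equal s₁ s₂ =>
      obtain ⟨i, rfl⟩ := hterm s₁
      obtain ⟨j, rfl⟩ := hterm s₂
      simpa [BoundedFormula.realize_bdEqual] using heq i j
    | rel R ts =>
      cases R
      choose f hf using fun i => hterm (ts i)
      obtain rfl : ts = fun i => Term.var (Sum.inr (f i)) := funext hf
      have e : ∀ {X : Type} (s : Fin m → X), (fun i => s (f i)) = ![s (f 0), s (f 1)] := by
        intro X s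
        ext i; fin_cases i <;> rfl
      have h1 := hE (f 0) (f 1)
      unfold E at h1
      rw [← e t, ← e t'] at h1
      exact h1
  | imp _ _ h₁ h₂ =>
    rw [BoundedFormula.realize_imp, BoundedFormula.realize_imp]
    exact imp_congr h₁ h₂

theorem sub_mem (M : Type) [Language.graph.Structure M] (h : InUndirPaths M)
    (N : Language.graph.Substructure M) : InUndirPaths N := by
  have hE : ∀ x y : N, E N x y ↔ E M x y := by
    intro x y
    show Structure.RelMap _ _ ↔ _
    have : (![(x : M), (y : M)]) = fun i => ((![x, y] i : N) : M) := by
      ext i; fin_cases i <;> rfl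
    unfold E
    rw [this]
    rfl
  obtain ⟨h1, h2, h3, h4, h5⟩ := h
  refine ⟨inferInstance, ?_, ?_, ?_, ?_⟩
  · intro x y; rw [hE, hE]; exact h2 _ _
  · intro x; rw [hE]; exact h3 _
  · intro v a b c; simp only [hE, Subtype.ext_iff]; exact h4 _ _ _ _
  · intro m f hf hh
    exact h5 m (fun i => f i) (Subtype.val_injective.comp hf) fun i => (hE _ _).1 (hh i)

theorem core_part (B : ℕ) (M : Type) [Language.graph.Structure M] (h : InUndirPaths M)
    (hM : M ⊨ theSentence B) : ∃ C : Finset M, C.card ≤ B ∧ IsCore (theSentence B) M ↑C := by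
  classical
  rw [realize_theSentence, sem_iff M h] at hM
  obtain ⟨f, hf⟩ := hM
  refine ⟨Finset.univ.image f, ?_, ?_⟩
  · simpa using Finset.card_image_le (s := Finset.univ) (f := f)
  · intro N hC _
    rw [realize_theSentence, sem_iff N (sub_mem M h N)]
    refine ⟨fun i => ⟨f i, hC (by simp)⟩, fun i j hij hh => hf i j hij ?_⟩
    refine Relation.ReflTransGen.lift (Subtype.val : N → M) ?_ _ _ hh
    intro x y hxy
    have : (![(x : M), (y : M)]) = fun i => ((![x, y] i : N) : M) := by
      ext i; fin_cases i <;> rfl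
    show Structure.RelMap _ _
    rw [this]
    exact hxy

/-- ambient adjacency -/
def Amb (p q : ℕ × ℤ) : Prop := p.1 = q.1 ∧ (q.2 = p.2 + 1 ∨ p.2 = q.2 + 1)

/-- disjoint union of paths indexed by I with lengths len -/
def PG (I : Finset ℕ) (len : ℕ → ℤ) : Type :=
  {p : ℕ × ℤ // p.1 ∈ I ∧ 0 ≤ p.2 ∧ p.2 < len p.1}

instance (I : Finset ℕ) (len : ℕ → ℤ) : Language.graph.Structure (PG I len) where
  funMap := fun f => isEmptyElim f
  RelMap | .adj => fun x => Amb (x 0).1 (x 1).1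

theorem PG_E {I : Finset ℕ} {len : ℕ → ℤ} (x y : PG I len) :
    E (PG I len) x y ↔ Amb x.1 y.1 := Iff.rfl

theorem PG_mem (I : Finset ℕ) (len : ℕ → ℤ) : InUndirPaths (PG I len) := by
  classical
  refine ⟨?_, ?_, ?_, ?_, ?_⟩
  · have : Set.Finite {p : ℕ × ℤ | p.1 ∈ I ∧ 0 ≤ p.2 ∧ p.2 < len p.1} := by
      refine (I.biUnion fun i => (Finset.Ico 0 (len i)).image
        fun x => (i, x)).finite_toSet.subset ?_
      rintro ⟨i, x⟩ ⟨h1, h2, h3⟩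
      simp only [Finset.coe_biUnion, Set.mem_iUnion, Finset.coe_image, Set.mem_image]
      exact ⟨i, h1, x, by simp; exact ⟨h2, h3⟩, rfl⟩
    exact this.to_subtype
  · intro x y; simp only [PG_E, Amb]; rintro ⟨h, h'⟩; exact ⟨h.symm, h'.symm⟩
  · intro x; simp [PG_E, Amb]
  · intro v a b c
    simp only [PG_E, Amb]
    rintro ⟨h1, h1'⟩ ⟨h2, h2'⟩ ⟨h3, h3'⟩
    have key : ∀ x y : PG I len, x.1.1 = y.1.1 → x.1.2 = y.1.2 → x = y :=
      fun x y h h' => Subtype.ext (Prod.ext h h')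
    by_cases hab : a.1.2 = b.1.2
    · exact Or.inl (key _ _ (by omega) hab)
    by_cases hac : a.1.2 = c.1.2
    · exact Or.inr (Or.inl (key _ _ (by omega) hac))
    exact Or.inr (Or.inr (key _ _ (by omega) (by omega)))
  · intro m f hf hh
    obtain ⟨i, hi⟩ := Finite.exists_max (fun i => (f i).1.2)
    obtain ⟨k, rfl⟩ : ∃ k, i = k + 1 := ⟨i - 1, by simp⟩
    have h1 := (PG_E _ _).1 (hh k)
    have h2 := (PG_E _ _).1 (hh (k + 1))
    have h3 := hi k
    have h4 := hi (k + 1 + 1)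
    simp only [Amb] at h1 h2
    have : f (k + 1 + 1) = f k := Subtype.ext (Prod.ext (by omega) (by omega))
    have := hf this
    rw [add_assoc, add_eq_left] at this
    simp [Fin.ext_iff, Fin.val_add] at this
    rw [Nat.mod_eq_of_lt (by omega)] at this
    omega

theorem PG_reach {I : Finset ℕ} {len : ℕ → ℤ} (d : ℕ) : ∀ x y : PG I len, x.1.1 = y.1.1 →
    y.1.2 = x.1.2 + d → Relation.ReflTransGen (E (PG I len)) x y := by
  induction d with
  | zero =>
    intro x y h h'
    obtain rfl : x = y := Subtype.ext (Prod.ext h (by omega))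
    exact .refl
  | succ d ih =>
    intro x y h h'
    have hx := x.2
    have hy := y.2
    push_cast at h'
    have hz : (x.1.1, x.1.2 + d).1 ∈ I ∧ 0 ≤ (x.1.1, x.1.2 + d).2 ∧
        (x.1.1, x.1.2 + d).2 < len (x.1.1, x.1.2 + d).1 := by
      refine ⟨hx.1, ?_, ?_⟩
      · simp; omega
      · simp only; rw [h]; omega
    refine (ih x ⟨(x.1.1, x.1.2 + d), hz⟩ rfl rfl).tail ?_
    show Amb (x.1.1, x.1.2 + d) y.1
    exact ⟨h, Or.inl (by simp only; omega)⟩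

theorem PG_not {I : Finset ℕ} {len : ℕ → ℤ} {B : ℕ} (hI : I.card < B) :
    ¬ AtLeastComponents (PG I len) B := by
  rintro ⟨f, hf⟩
  obtain ⟨i, -, j, -, hij, he⟩ := Finset.exists_ne_map_eq_of_card_lt_of_maps_to
    (s := (Finset.univ : Finset (Fin B))) (t := I) (by simpa using hI)
    (f := fun i => (f i).1.1) (fun i _ => (f i).2.1)
  rcases le_total (f i).1.2 (f j).1.2 with h | h
  · exact hf i j hij (PG_reach ((f j).1.2 - (f i).1.2).toNat _ _ he (by omega))
  · exact hf j i hij.symm (PG_reach ((f i).1.2 - (f j).1.2).toNat _ _ he.symm (by omega))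

theorem PG_yes {B : ℕ} {L : ℤ} (hL : 0 < L) :
    AtLeastComponents (PG (Finset.range B) fun _ => L) B := by
  refine ⟨fun i => ⟨(i, 0), by simp, by simp, hL⟩, fun i j hij hh => hij ?_⟩
  have : ∀ x y : PG (Finset.range B) fun _ => L,
      Relation.ReflTransGen (E (PG (Finset.range B) fun _ => L)) x y → x.1.1 = y.1.1 := by
    intro x y h
    induction h with
    | refl => rfl
    | tail _ h ih => exact ih.trans h.1
  exact Fin.ext (this _ _ hh)

theorem PG_transfer {I I' : Finset ℕ} {len len' : ℕ → ℤ} {B n : ℕ}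
    {β : Language.graph.BoundedFormula Empty (B + n)} (hβ : β.IsQF)
    (a : Fin B → PG I len)
    (ha : ∀ t : Fin (B + n) → PG I len, (∀ i, t (Fin.castAdd n i) = a i) → β.Realize default t)
    (b : Fin B → PG I' len')
    (hb : ∀ t : Fin (B + n) → PG I' len', (∀ i, t (Fin.castAdd n i) = b i) →
      ∃ g : ℕ × ℤ → ℕ × ℤ,
        (∀ i, g (t i).1 ∈ {p : ℕ × ℤ | p.1 ∈ I ∧ 0 ≤ p.2 ∧ p.2 < len p.1}) ∧
        (∀ i, g (b i).1 = (a i).1) ∧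
        (∀ i j, (t i).1 = (t j).1 ↔ g (t i).1 = g (t j).1) ∧
        (∀ i j, Amb (t i).1 (t j).1 ↔ Amb (g (t i).1) (g (t j).1))) :
    PG I' len' ⊨ sigma2 B n β := by
  rw [realize_sigma2]
  refine ⟨b, fun t ht => ?_⟩
  obtain ⟨g, h1, h2, h3, h4⟩ := hb t ht
  let t' : Fin (B + n) → PG I len := fun i => ⟨g (t i).1, h1 i⟩
  rw [qf_transfer β hβ t t']
  · apply ha
    intro i
    apply Subtype.ext
    show g (t (Fin.castAdd n i)).1 = _
    rw [ht, h2]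
  · intro i j
    constructor
    · intro h; exact Subtype.ext ((h3 i j).1 (congrArg Subtype.val h))
    · intro h; exact Subtype.ext ((h3 i j).2 (congrArg Subtype.val h))
  · intro i j
    exact h4 i j

/-- optional reflection -/
def fl (L : ℤ) (s : Bool) (x : ℤ) : ℤ := if s then L - 1 - x else x

theorem fl_fl (L : ℤ) (s : Bool) (x : ℤ) : fl L s (fl L s x) = x := by
  cases s <;> simp [fl]

/-- the gluing map -/
def glue (L : ℤ) (s0 s1 : Bool) (v e : ℤ) (z : ℕ × ℤ) : ℕ × ℤ :=
  if z.1 = 0 then (if z.2 ≤ v then (0, fl L s0 z.2) else (1, fl L s1 (z.2 + e))) else z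

theorem glue_eq (L : ℤ) (s0 s1 : Bool) (v e : ℤ) (z w : ℕ × ℤ) (hz : z.1 ≠ 1) (hw : w.1 ≠ 1) :
    z = w ↔ glue L s0 s1 v e z = glue L s0 s1 v e w := by
  obtain ⟨i, x⟩ := z
  obtain ⟨j, y⟩ := w
  simp only at hz hw
  cases s0 <;> cases s1 <;> simp only [glue, fl, Bool.false_eq_true, if_true, if_false] <;> split_ifs <;> simp only [Prod.mk.injEq] <;>
    constructor <;> rintro ⟨h1, h2⟩ <;> first | omega | (constructor <;> omega) | grind

theorem glue_amb (L : ℤ) (s0 s1 : Bool) (v e : ℤ) (z w : ℕ × ℤ) (hz : z.1 ≠ 1) (hw : w.1 ≠ 1)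
    (hz' : z.2 ≠ v) (hw' : w.2 ≠ v) :
    Amb z w ↔ Amb (glue L s0 s1 v e z) (glue L s0 s1 v e w) := by
  obtain ⟨i, x⟩ := z
  obtain ⟨j, y⟩ := w
  simp only at hz hw hz' hw'
  cases s0 <;> cases s1 <;> simp only [glue, fl, Amb, Bool.false_eq_true, if_true, if_false] <;> split_ifs <;> first | omega | (simp only <;> omega) | grind

theorem no_sigma2 (B : ℕ) (hB : 2 ≤ B) (n : ℕ)
    (β : Language.graph.BoundedFormula Empty (B + n)) (hβ : β.IsQF)
    (H : ∀ (M : Type) [Language.graph.Structure M] [Nonempty M], InUndirPaths M →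
      (AtLeastComponents M B ↔ M ⊨ sigma2 B n β)) : False := by
  classical
  obtain ⟨K, hK⟩ : ∃ K : ℤ, K = B + n + 1 := ⟨_, rfl⟩
  obtain ⟨L, hL⟩ : ∃ L : ℤ, L = 2 * K + 2 := ⟨_, rfl⟩
  have hM := PG_yes (B := B) (L := L) (by omega)
  have hne : Nonempty (PG (Finset.range B) fun _ => L) := ⟨hM.choose ⟨0, by omega⟩⟩
  rw [H _ (PG_mem _ _), realize_sigma2] at hM
  obtain ⟨a, ha⟩ := hM
  have haB : ∀ i, (a i).1.1 < B := fun i => Finset.mem_range.1 (a i).2.1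
  have hcontra : ∀ (i0 : ℕ) (len' : ℕ → ℤ), i0 < B →
      (Fin B → PG ((Finset.range B).erase i0) len') →
      ¬ (PG ((Finset.range B).erase i0) len' ⊨ sigma2 B n β) := by
    intro i0 len' hi0 b hh
    have : Nonempty (PG ((Finset.range B).erase i0) len') := ⟨b ⟨0, by omega⟩⟩
    rw [← H _ (PG_mem _ _)] at hh
    refine PG_not ?_ hh
    rw [Finset.card_erase_of_mem (by simpa using hi0)]
    simp; omega
  by_cases hsurj : Function.Surjective (fun i => (⟨(a i).1.1, haB i⟩ : Fin B))
  swap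
  · simp only [Function.Surjective, not_forall, not_exists] at hsurj
    obtain ⟨i0, hi0⟩ := hsurj
    have hb : ∀ i, (a i).1.1 ≠ i0.1 := fun i h => hi0 i (Fin.ext h)
    let b : Fin B → PG ((Finset.range B).erase i0.1) (fun _ => L) :=
      fun i => ⟨(a i).1, Finset.mem_erase.2 ⟨hb i, (a i).2.1⟩, (a i).2.2⟩
    refine hcontra i0.1 (fun _ => L) i0.2 b (PG_transfer hβ a ha b fun t ht => ⟨id, ?_, ?_, ?_, ?_⟩)
    · intro i
      exact ⟨(Finset.mem_erase.1 (t i).2.1).2, (t i).2.2⟩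
    · intro i; rfl
    · intro i j; rfl
    · intro i j; rfl
  have hinj := Finite.injective_iff_surjective.2 hsurj
  have hinj' : ∀ i j, (a i).1.1 = (a j).1.1 → i = j := fun i j h => hinj (Fin.ext h)
  obtain ⟨j0, h0⟩ := hsurj ⟨0, by omega⟩
  obtain ⟨j1, h1⟩ := hsurj ⟨1, by omega⟩
  replace h0 : (a j0).1.1 = 0 := congrArg Fin.val h0
  replace h1 : (a j1).1.1 = 1 := congrArg Fin.val h1
  have h01 : j0 ≠ j1 := by rintro rfl; omega
  have ha0 : 0 ≤ (a j0).1.2 ∧ (a j0).1.2 < L := (a j0).2.2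
  have ha1 : 0 ≤ (a j1).1.2 ∧ (a j1).1.2 < L := (a j1).2.2
  obtain ⟨s0, p, hp, hp0, hpK⟩ : ∃ s0 p, p = fl L s0 (a j0).1.2 ∧ 0 ≤ p ∧ p + K < L := by
    by_cases h : (a j0).1.2 + K < L
    · exact ⟨false, _, rfl, by simp [fl]; omega, by simpa [fl] using h⟩
    · exact ⟨true, _, rfl, by simp [fl]; omega, by simp [fl]; omega⟩
  obtain ⟨s1, q, hq, hqK, hqL⟩ : ∃ s1 q, q = fl L s1 (a j1).1.2 ∧ K ≤ q ∧ q < L := by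
    by_cases h : K ≤ (a j1).1.2
    · exact ⟨false, _, rfl, by simpa [fl] using h, by simp [fl]; omega⟩
    · exact ⟨true, _, rfl, by simp [fl]; omega, by simp [fl]; omega⟩
  let len' : ℕ → ℤ := fun i => if i = 0 then p + K + 1 + (L - q) else L
  let bb : Fin B → ℕ × ℤ := fun j => if j = j0 then (0, p) else if j = j1 then (0, p + K + 1)
    else (a j).1
  have hbb : ∀ j, (bb j).1 ∈ (Finset.range B).erase 1 ∧ 0 ≤ (bb j).2 ∧ (bb j).2 < len' (bb j).1 := by
    intro j
    by_cases hj0 : j = j0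
    · simp [bb, len', hj0]; omega
    by_cases hj1 : j = j1
    · simp [bb, len', hj1, h01.symm]; omega
    · have e0 : (a j).1.1 ≠ 0 := fun h => hj0 (hinj' _ _ (h.trans h0.symm))
      have e1 : (a j).1.1 ≠ 1 := fun h => hj1 (hinj' _ _ (h.trans h1.symm))
      have := (a j).2
      simp [bb, len', hj0, hj1, e0, e1]
      exact ⟨haB j, this.2⟩
  let b : Fin B → PG ((Finset.range B).erase 1) len' := fun j => ⟨bb j, hbb j⟩
  refine hcontra 1 len' (by omega) b (PG_transfer hβ a ha b fun t ht => ?_)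
  obtain ⟨v, hv, hvt⟩ : ∃ v ∈ Finset.Icc (p + 1) (p + K),
      v ∉ Finset.univ.image (fun i => (t i).1.2) := by
    apply Finset.exists_mem_notMem_of_card_lt_card
    refine lt_of_le_of_lt Finset.card_image_le ?_
    simp; omega
  rw [Finset.mem_Icc] at hv
  have hvt' : ∀ i, (t i).1.2 ≠ v := fun i h => hvt (by simp only [Finset.mem_image]; exact ⟨i, by simp, h⟩)
  have ht1 : ∀ i, (t i).1.1 ≠ 1 := fun i => (Finset.mem_erase.1 (t i).2.1).1
  refine ⟨glue L s0 s1 v (q - (p + K + 1)), ?_, ?_,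
    fun i j => glue_eq _ _ _ _ _ _ _ (ht1 i) (ht1 j),
    fun i j => glue_amb _ _ _ _ _ _ _ (ht1 i) (ht1 j) (hvt' i) (hvt' j)⟩
  · intro i
    have hm := (t i).2
    have hm1 := hvt' i
    generalize (t i).1 = z at hm hm1
    obtain ⟨c, x⟩ := z
    simp only [Finset.mem_erase, Finset.mem_range, len'] at hm
    simp only at hm1
    simp only [Set.mem_ofPred_eq, Finset.mem_range, glue]
    split_ifs with g1 g2
    · rw [if_pos g1] at hm
      cases s0 <;> simp [fl] <;> omega
    · rw [if_pos g1] at hm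
      cases s1 <;> simp [fl] <;> omega
    · rw [if_neg g1] at hm
      exact ⟨hm.1.2, hm.2⟩
  · intro j
    show glue _ _ _ _ _ (bb j) = _
    by_cases hj0 : j = j0
    · have : p ≤ v := by omega
      simp only [bb, hj0, if_true, glue, this]
      rw [hp, fl_fl]
      exact Prod.ext h0.symm rfl
    by_cases hj1 : j = j1
    · have : ¬ (p + K + 1 ≤ v) := by omega
      simp only [bb, hj1, h01.symm, if_true, if_false, glue, this]
      rw [show p + K + 1 + (q - (p + K + 1)) = q by ring, hq, fl_fl]
      exact Prod.ext h1.symm rfl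
    · have e0 : (a j).1.1 ≠ 0 := fun h => hj0 (hinj' _ _ (h.trans h0.symm))
      simp only [bb, hj0, hj1, if_false, glue, e0]

/-- Over the class 𝒞 of finite disjoint unions of finite undirected paths: for each `B ≥ 2`,
the condition "there are at least `B` connected components (paths, including isolated
vertices)" is FO-definable by a sentence `φ`; `φ ∈ PSC(B)` over 𝒞, but `φ` is not equivalent
over 𝒞 to any sentence of the form `∃x₁…x_B ∀y₁…y_n β` with `β` quantifier-free. -/
theorem statement16 (B : ℕ) (hB : 2 ≤ B) :
    ∃ φ : Language.graph.Sentence,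
      (∀ (M : Type) [Language.graph.Structure M] [Nonempty M], InUndirPaths M →
          (M ⊨ φ ↔ AtLeastComponents M B)) ∧
      (∀ (M : Type) [Language.graph.Structure M] [Nonempty M], InUndirPaths M → M ⊨ φ →
          ∃ C : Finset M, C.card ≤ B ∧ IsCore φ M ↑C) ∧
      ¬ ∃ (n : ℕ) (β : Language.graph.BoundedFormula Empty (B + n)), β.IsQF ∧
          ∀ (M : Type) [Language.graph.Structure M] [Nonempty M], InUndirPaths M →
            (M ⊨ φ ↔ M ⊨ sigma2 B n β) := by
  refine ⟨theSentence B, ?_, ?_, ?_⟩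
  · intro M _ _ h
    rw [realize_theSentence, sem_iff M h]
  · intro M _ _ h hM
    exact core_part B M h hM
  · rintro ⟨n, β, hβ, H⟩
    refine no_sigma2 B hB n β hβ ?_
    intro M _ _ h
    rw [← H M h, realize_theSentence, sem_iff M h]

end Stmt
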